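/- Let Γ be a group and α, β : Γ → ℤ group homomorphisms, and suppose there is a 2-cycle (N; x_1,…,x_N; a_1,…,a_N; b_1,…,b_N) on Γ with Σ_{j=1}^N x_j·α(a_j)β(b_j) ≠ 0. Then there is no sequence of group homomorphisms ψ_n : Γ → U(n) such that ‖ψ_n(g) − ρ_n(g)‖_F → 0 as n → ∞ for every g ∈ Γ; that is, the asymptotic homomorphism (ρ_n) is not perturbable to genuine representations in the unnormalized Frobenius norm. -/

import Mathlib

open Filter

/-- `ω_n = exp(2πi/n)`. -/
noncomputable def voiOmega (n : ℕ) : ℂ :=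
  Complex.exp (2 * Real.pi * Complex.I / n)

/-- The `n × n` Voiculescu cyclic-shift unitary `u_n`, whose `(i,j)` entry is `1`
when `i ≡ j + 1 (mod n)` and `0` otherwise. -/
noncomputable def voiU (n : ℕ) : Matrix (Fin n) (Fin n) ℂ :=
  Matrix.of fun i j => if (i : ℕ) = ((j : ℕ) + 1) % n then 1 else 0

/-- The `n × n` Voiculescu diagonal unitary `v_n`, whose `j`-th diagonal entry is
`ω_n ^ j` for `j = 1, …, n`. -/
noncomputable def voiV (n : ℕ) : Matrix (Fin n) (Fin n) ℂ :=
  Matrix.diagonal fun j => voiOmega n ^ ((j : ℕ) + 1)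

/-- Given homomorphisms `α, β : Γ → ℤ`, the map `ρ_n(g) = u_n ^ α(g) * v_n ^ β(g)`. -/
noncomputable def voiRho {Γ : Type*} [Group Γ] (α β : Γ → ℤ) (n : ℕ) (g : Γ) :
    Matrix (Fin n) (Fin n) ℂ :=
  voiU n ^ α g * voiV n ^ β g

/-- The data `(x_j, a_j, b_j)_{j=1}^N` is a 2-cycle on `Γ` when
`Σ_j x_j([a_j] − [a_j b_j] + [b_j]) = 0` in the free abelian group `ℤ[Γ]`. -/
def IsTwoCycle {Γ : Type*} [Group Γ] {N : ℕ} (x : Fin N → ℤ) (a b : Fin N → Γ) : Prop :=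
  ∑ j : Fin N,
    (Finsupp.single (a j) (x j) - Finsupp.single (a j * b j) (x j)
      + Finsupp.single (b j) (x j)) = (0 : Γ →₀ ℤ)

/-- The unnormalized Frobenius (Hilbert–Schmidt) norm `‖M‖_F = (Σ_{i,j} |M_{ij}|²)^{1/2}`. -/
noncomputable def frobNorm {n : ℕ} (M : Matrix (Fin n) (Fin n) ℂ) : ℝ :=
  Real.sqrt (∑ i, ∑ j, ‖M i j‖ ^ 2)

section

open Matrix

lemma frobNorm_sq {n : ℕ} (M : Matrix (Fin n) (Fin n) ℂ) :
    (((∑ i, ∑ j, ‖M i j‖ ^ 2 : ℝ)) : ℂ) = (M * Mᴴ).trace := by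
  simp [Matrix.trace, Matrix.mul_apply, Complex.mul_conj, Complex.normSq_eq_norm_sq]

lemma frobNorm_eq_of_trace_eq {n : ℕ} {M M' : Matrix (Fin n) (Fin n) ℂ}
    (h : (M * Mᴴ).trace = (M' * M'ᴴ).trace) : frobNorm M = frobNorm M' := by
  rw [← frobNorm_sq, ← frobNorm_sq] at h
  rw [frobNorm, frobNorm, Complex.ofReal_injective h]

lemma frobNorm_mul_unitary {n : ℕ} (M : Matrix (Fin n) (Fin n) ℂ)
    (U : unitaryGroup (Fin n) ℂ) : frobNorm (M * (U : Matrix (Fin n) (Fin n) ℂ)) = frobNorm M := by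
  apply frobNorm_eq_of_trace_eq
  have h : (U : Matrix (Fin n) (Fin n) ℂ) * (U : Matrix (Fin n) (Fin n) ℂ)ᴴ = 1 :=
    Unitary.coe_mul_star_self U
  rw [conjTranspose_mul, Matrix.mul_assoc, ← Matrix.mul_assoc (U : Matrix (Fin n) (Fin n) ℂ), h,
    Matrix.one_mul]

lemma frobNorm_unitary_mul {n : ℕ} (U : unitaryGroup (Fin n) ℂ)
    (M : Matrix (Fin n) (Fin n) ℂ) : frobNorm ((U : Matrix (Fin n) (Fin n) ℂ) * M) = frobNorm M := by
  apply frobNorm_eq_of_trace_eq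
  have h : (U : Matrix (Fin n) (Fin n) ℂ)ᴴ * (U : Matrix (Fin n) (Fin n) ℂ) = 1 :=
    Unitary.coe_star_mul_self U
  rw [conjTranspose_mul, trace_mul_comm, Matrix.mul_assoc,
    ← Matrix.mul_assoc _ (U : Matrix (Fin n) (Fin n) ℂ), h, Matrix.one_mul, trace_mul_comm]

lemma norm_trace_mul_le {n : ℕ} (X Y : Matrix (Fin n) (Fin n) ℂ) :
    ‖(X * Y).trace‖ ≤ frobNorm X * frobNorm Y := by
  have h1 : ‖(X * Y).trace‖ ≤ ∑ p : Fin n × Fin n, ‖X p.1 p.2‖ * ‖Y p.2 p.1‖ := by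
    rw [Fintype.sum_prod_type, Matrix.trace]
    refine (norm_sum_le _ _).trans (Finset.sum_le_sum fun i _ => ?_)
    rw [Matrix.diag_apply, Matrix.mul_apply]
    exact (norm_sum_le _ _).trans (Finset.sum_le_sum fun j _ => (norm_mul _ _).le)
  refine h1.trans ((Real.sum_mul_le_sqrt_mul_sqrt _ _ _).trans_eq ?_)
  rw [frobNorm, frobNorm, Fintype.sum_prod_type, Fintype.sum_prod_type_right]

lemma frobNorm_one (n : ℕ) : frobNorm (1 : Matrix (Fin n) (Fin n) ℂ) = √n := by
  rw [frobNorm]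
  congr 1
  apply Complex.ofReal_injective
  rw [frobNorm_sq]
  simp

lemma norm_trace_le {n : ℕ} (X : Matrix (Fin n) (Fin n) ℂ) :
    ‖X.trace‖ ≤ frobNorm X * √n := by
  simpa [frobNorm_one] using norm_trace_mul_le X 1

lemma voiOmega_zpow (n : ℕ) (k : ℤ) :
    voiOmega n ^ k = Complex.exp (2 * Real.pi * Complex.I * k * (n : ℂ)⁻¹) := by
  rw [voiOmega, ← Complex.exp_int_mul]
  congr 1
  ring

lemma voiOmega_pow_self {n : ℕ} (hn : n ≠ 0) : voiOmega n ^ n = 1 := by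
  have := voiOmega_zpow n n
  rw [zpow_natCast] at this
  rw [this, Int.cast_natCast, mul_assoc, mul_inv_cancel₀ (by exact_mod_cast hn), mul_one,
    Complex.exp_two_pi_mul_I]

lemma norm_voiOmega (n : ℕ) : ‖voiOmega n‖ = 1 := by
  have : (2 * Real.pi * Complex.I / n : ℂ) = ((2 * Real.pi / n : ℝ) : ℂ) * Complex.I := by
    push_cast; ring
  rw [voiOmega, this, Complex.norm_exp_ofReal_mul_I]

lemma voiU_mem (n : ℕ) : voiU n ∈ unitaryGroup (Fin n) ℂ := by
  rcases Nat.eq_zero_or_pos n with rfl | hn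
  · rw [mem_unitaryGroup_iff]; exact Subsingleton.elim _ _
  have : NeZero n := ⟨hn.ne'⟩
  have h : voiU n = Equiv.Perm.permMatrix ℂ (Equiv.addRight (1 : Fin n)).symm := by
    ext i j
    rw [voiU, Matrix.of_apply, Equiv.Perm.permMatrix, PEquiv.toMatrix_apply]
    simp only [Equiv.toPEquiv_apply, Option.mem_some_iff]
    refine if_congr ?_ rfl rfl
    rw [Equiv.symm_apply_eq, Equiv.coe_addRight, Fin.ext_iff, Fin.val_add, Fin.val_one', Nat.add_mod_mod]
  rw [h, mem_unitaryGroup_iff, star_eq_conjTranspose, conjTranspose_permMatrix,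
    ← permMatrix_mul, inv_mul_cancel, permMatrix_one]

lemma voiV_mem (n : ℕ) : voiV n ∈ unitaryGroup (Fin n) ℂ := by
  rw [mem_unitaryGroup_iff, star_eq_conjTranspose, voiV, diagonal_conjTranspose,
    diagonal_mul_diagonal, ← diagonal_one]
  congr 1
  ext j
  simp [← mul_pow, Complex.mul_conj, Complex.normSq_eq_norm_sq, norm_voiOmega]

lemma voiV_mul_voiU (n : ℕ) : voiV n * voiU n = voiOmega n • (voiU n * voiV n) := by
  ext i j
  have hn : n ≠ 0 := (Fin.pos i).ne'
  rw [voiV, diagonal_mul, Matrix.smul_apply, mul_diagonal, voiU, of_apply, smul_eq_mul]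
  split_ifs with h
  · have : voiOmega n ^ (i : ℕ) = voiOmega n ^ ((j : ℕ) + 1) := by
      rw [h, ← pow_mod_orderOf, Nat.mod_mod_of_dvd _ (orderOf_dvd_of_pow_eq_one (voiOmega_pow_self hn)),
        pow_mod_orderOf]
    rw [pow_succ, this]; ring
  · simp

lemma zpow_mul_zpow_of_mul_eq {G : Type*} [Group G] {u v z : G} (hz : ∀ g, Commute z g)
    (h : v * u = z * (u * v)) (k l : ℤ) : v ^ l * u ^ k = z ^ (l * k) * (u ^ k * v ^ l) := by
  have h1 : SemiconjBy v (u ^ k) ((z * u) ^ k) := SemiconjBy.zpow_right (by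
    rw [SemiconjBy, h, mul_assoc]) k
  rw [(hz u).mul_zpow] at h1
  have h2 : SemiconjBy (u ^ k) ((z ^ k * v) ^ l) (v ^ l) := SemiconjBy.zpow_right (by
    rw [SemiconjBy, h1.eq, ← mul_assoc, ((hz (u ^ k)).zpow_left k).eq]) l
  rw [((hz v).zpow_left k).mul_zpow, ← _root_.zpow_mul, mul_comm k] at h2
  rw [← h2.eq, ← mul_assoc, ← mul_assoc, ((hz (u ^ k)).zpow_left _).eq]

/-- `ρ_n(g)` as a unitary matrix. -/
noncomputable def voiRhoUnitary {Γ : Type*} [Group Γ] (α β : Γ → ℤ) (n : ℕ) (g : Γ) :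
    unitaryGroup (Fin n) ℂ :=
  ⟨voiU n, voiU_mem n⟩ ^ α g * ⟨voiV n, voiV_mem n⟩ ^ β g

lemma coe_unitary_zpow {n : ℕ} (U : unitaryGroup (Fin n) ℂ) (k : ℤ) :
    ((U ^ k : unitaryGroup (Fin n) ℂ) : Matrix (Fin n) (Fin n) ℂ) =
      (U : Matrix (Fin n) (Fin n) ℂ) ^ k := by
  have := Matrix.coe_units_zpow (Unitary.toUnits U) k
  rw [← map_zpow] at this
  exact this

lemma coe_voiRhoUnitary {Γ : Type*} [Group Γ] (α β : Γ → ℤ) (n : ℕ) (g : Γ) :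
    (voiRhoUnitary α β n g : Matrix (Fin n) (Fin n) ℂ) = voiRho α β n g := by
  rw [voiRhoUnitary, voiRho, UnitaryGroup.mul_val, coe_unitary_zpow, coe_unitary_zpow]

lemma voiRho_mul_voiRho {Γ : Type*} [Group Γ] {α β : Γ → ℤ}
    (hα : ∀ g h : Γ, α (g * h) = α g + α h) (hβ : ∀ g h : Γ, β (g * h) = β g + β h)
    (n : ℕ) (g h : Γ) :
    voiRho α β n g * voiRho α β n h =
      voiOmega n ^ (β g * α h) • voiRho α β n (g * h) := by
  let u : (Matrix (Fin n) (Fin n) ℂ)ˣ := Unitary.toUnits ⟨voiU n, voiU_mem n⟩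
  let v : (Matrix (Fin n) (Fin n) ℂ)ˣ := Unitary.toUnits ⟨voiV n, voiV_mem n⟩
  let w : ℂˣ := Units.mk0 (voiOmega n) (Complex.exp_ne_zero _)
  let c : ℂˣ →* (Matrix (Fin n) (Fin n) ℂ)ˣ :=
    Units.map (algebraMap ℂ (Matrix (Fin n) (Fin n) ℂ)).toMonoidHom
  have hc (y : ℂˣ) (M : (Matrix (Fin n) (Fin n) ℂ)ˣ) :
      ((c y * M : (Matrix (Fin n) (Fin n) ℂ)ˣ) : Matrix (Fin n) (Fin n) ℂ) = (y : ℂ) • M.val := by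
    rw [Units.val_mul, Algebra.smul_def]; rfl
  have hz (M) : Commute (c w) M := Units.ext (Algebra.commutes _ _)
  have hvu : v * u = c w * (u * v) := by
    ext1
    rw [hc]
    exact voiV_mul_voiU n
  have key : (u ^ α g * v ^ β g) * (u ^ α h * v ^ β h) =
      c (w ^ (β g * α h)) * (u ^ α (g * h) * v ^ β (g * h)) := by
    rw [hα, hβ, _root_.zpow_add, _root_.zpow_add, map_zpow, mul_assoc, ← mul_assoc (v ^ β g),
      zpow_mul_zpow_of_mul_eq hz hvu, ← mul_assoc (u ^ α g), ← mul_assoc (u ^ α g),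
      ← ((hz (u ^ α g)).zpow_left _).eq]
    simp only [mul_assoc]
  have hval := congrArg Units.val key
  rw [hc, Units.val_zpow_eq_zpow_val] at hval
  simp only [Units.val_mul, Matrix.coe_units_zpow] at hval
  exact hval

/-- The trace of `ψ(g) ρ_n(g)* - 1`. -/
noncomputable def traceDefect {Γ : Type*} [Group Γ] (α β : Γ → ℤ) (n : ℕ)
    (ψ : Γ →* unitaryGroup (Fin n) ℂ) (g : Γ) : ℂ :=
  ((ψ g : Matrix (Fin n) (Fin n) ℂ) * (voiRho α β n g)ᴴ - 1).trace

lemma frobNorm_mul_conjTranspose_sub_one {n : ℕ} (A R : unitaryGroup (Fin n) ℂ) :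
    frobNorm ((A : Matrix (Fin n) (Fin n) ℂ) * (R : Matrix (Fin n) (Fin n) ℂ)ᴴ - 1) =
      frobNorm ((A : Matrix (Fin n) (Fin n) ℂ) - (R : Matrix (Fin n) (Fin n) ℂ)) := by
  rw [← frobNorm_mul_unitary _ R, Matrix.sub_mul, Matrix.mul_assoc, Matrix.one_mul]
  have h : (R : Matrix (Fin n) (Fin n) ℂ)ᴴ * (R : Matrix (Fin n) (Fin n) ℂ) = 1 :=
    Unitary.coe_star_mul_self R
  rw [h, Matrix.mul_one]

lemma norm_traceDefect_le {Γ : Type*} [Group Γ] (α β : Γ → ℤ) (n : ℕ)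
    (ψ : Γ →* unitaryGroup (Fin n) ℂ) (g : Γ) :
    ‖traceDefect α β n ψ g‖ ≤
      frobNorm ((ψ g : Matrix (Fin n) (Fin n) ℂ) - voiRho α β n g) * √n := by
  rw [← coe_voiRhoUnitary, ← frobNorm_mul_conjTranspose_sub_one, coe_voiRhoUnitary]
  exact norm_trace_le _

lemma norm_traceDefect_mul_le {Γ : Type*} [Group Γ] {α β : Γ → ℤ}
    (hα : ∀ g h : Γ, α (g * h) = α g + α h) (hβ : ∀ g h : Γ, β (g * h) = β g + β h)
    (n : ℕ) (ψ : Γ →* unitaryGroup (Fin n) ℂ) (g h : Γ) :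
    ‖n + traceDefect α β n ψ (g * h) -
      voiOmega n ^ (β g * α h) * (n + traceDefect α β n ψ g + traceDefect α β n ψ h)‖ ≤
      frobNorm ((ψ g : Matrix (Fin n) (Fin n) ℂ) - voiRho α β n g) *
        frobNorm ((ψ h : Matrix (Fin n) (Fin n) ℂ) - voiRho α β n h) := by
  set ω := voiOmega n ^ (β g * α h) with hω
  have hω1 : ‖ω‖ = 1 := by rw [hω, norm_zpow, norm_voiOmega, _root_.one_zpow]
  have hωc : ω * star ω = 1 := by
    rw [Complex.star_def, Complex.mul_conj, Complex.normSq_eq_norm_sq, hω1]; simp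
  have hmul := voiRho_mul_voiRho hα hβ n g h
  simp only [traceDefect]
  simp only [← coe_voiRhoUnitary α β, ← hω] at hmul ⊢
  rw [← frobNorm_mul_conjTranspose_sub_one, ← frobNorm_mul_conjTranspose_sub_one (ψ h), map_mul,
    UnitaryGroup.mul_val]
  generalize voiRhoUnitary α β n g = A at *
  generalize voiRhoUnitary α β n h = B at *
  generalize voiRhoUnitary α β n (g * h) = C at *
  generalize ψ g = P
  generalize ψ h = Q
  have hA : (A : Matrix (Fin n) (Fin n) ℂ)ᴴ * (A : Matrix (Fin n) (Fin n) ℂ) = 1 :=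
    Unitary.coe_star_mul_self A
  have hC : (C : Matrix (Fin n) (Fin n) ℂ)ᴴ =
      ω • ((B : Matrix (Fin n) (Fin n) ℂ)ᴴ * (A : Matrix (Fin n) (Fin n) ℂ)ᴴ) := by
    rw [← conjTranspose_mul, hmul, conjTranspose_smul, smul_smul, hωc, one_smul]
  set D := (P : Matrix (Fin n) (Fin n) ℂ) * (A : Matrix (Fin n) (Fin n) ℂ)ᴴ - 1 with hD
  set E := (Q : Matrix (Fin n) (Fin n) ℂ) * (B : Matrix (Fin n) (Fin n) ℂ)ᴴ - 1 with hE
  have hPA : (P : Matrix (Fin n) (Fin n) ℂ) = (1 + D) * A := by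
    rw [hD, add_sub_cancel, Matrix.mul_assoc, hA, Matrix.mul_one]
  have hQB : (Q : Matrix (Fin n) (Fin n) ℂ) * (B : Matrix (Fin n) (Fin n) ℂ)ᴴ = 1 + E := by
    rw [hE, add_sub_cancel]
  have hA' : (A : Matrix (Fin n) (Fin n) ℂ) * (A : Matrix (Fin n) (Fin n) ℂ)ᴴ = 1 :=
    Unitary.coe_mul_star_self A
  have hprod : (P * Q * (C : Matrix (Fin n) (Fin n) ℂ)ᴴ : Matrix (Fin n) (Fin n) ℂ) =
      ω • (1 + D + (A : Matrix (Fin n) (Fin n) ℂ) * E * (A : Matrix (Fin n) (Fin n) ℂ)ᴴ +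
        D * ((A : Matrix (Fin n) (Fin n) ℂ) * E * (A : Matrix (Fin n) (Fin n) ℂ)ᴴ)) := by
    rw [hC, Matrix.mul_smul, Matrix.mul_assoc, ← Matrix.mul_assoc (Q : Matrix (Fin n) (Fin n) ℂ),
      hQB, hPA]
    congr 1
    have : (A : Matrix (Fin n) (Fin n) ℂ) * ((1 + E) * (A : Matrix (Fin n) (Fin n) ℂ)ᴴ) =
        1 + (A : Matrix (Fin n) (Fin n) ℂ) * E * (A : Matrix (Fin n) (Fin n) ℂ)ᴴ := by
      rw [Matrix.add_mul, Matrix.mul_add, Matrix.one_mul, hA', Matrix.mul_assoc]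
    rw [Matrix.mul_assoc, this]
    noncomm_ring
  have hconj : ((A : Matrix (Fin n) (Fin n) ℂ) * E * (A : Matrix (Fin n) (Fin n) ℂ)ᴴ).trace = E.trace := by
    rw [trace_mul_comm, ← Matrix.mul_assoc, hA, Matrix.one_mul]
  have hnorm : frobNorm ((A : Matrix (Fin n) (Fin n) ℂ) * E * (A : Matrix (Fin n) (Fin n) ℂ)ᴴ) = frobNorm E := by
    rw [← frobNorm_unitary_mul A E]
    exact frobNorm_mul_unitary _ (star A)
  rw [hprod, trace_sub, trace_smul, trace_add, trace_add, trace_add, hconj, trace_one,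
    Fintype.card_fin, smul_eq_mul]
  rw [show (n : ℂ) + (ω * (n + D.trace + E.trace +
      (D * ((A : Matrix (Fin n) (Fin n) ℂ) * E * (A : Matrix (Fin n) (Fin n) ℂ)ᴴ)).trace) - n) - ω * (n + D.trace + E.trace) =
      ω * (D * ((A : Matrix (Fin n) (Fin n) ℂ) * E * (A : Matrix (Fin n) (Fin n) ℂ)ᴴ)).trace by ring, norm_mul, hω1, one_mul,
    ← hnorm]
  exact norm_trace_mul_le _ _

lemma tendsto_mul_voiOmega_zpow_sub_one (k : ℤ) :
    Tendsto (fun n : ℕ => (n : ℂ) * (voiOmega n ^ k - 1)) atTop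
      (nhds (2 * Real.pi * Complex.I * k)) := by
  set c : ℂ := 2 * Real.pi * Complex.I * k with hc
  have hd : HasDerivAt (fun t : ℂ => Complex.exp (c * t)) c 0 := by
    simpa using ((hasDerivAt_id (0 : ℂ)).const_mul c).cexp
  have ht : Tendsto (fun n : ℕ => (n : ℂ)⁻¹) atTop (nhdsWithin 0 {0}ᶜ) := by
    refine tendsto_nhdsWithin_iff.2 ⟨tendsto_inv_atTop_nhds_zero_nat, ?_⟩
    filter_upwards [eventually_ne_atTop 0] with n hn
    simpa using hn
  refine ((hasDerivAt_iff_tendsto_slope_zero.1 hd).comp ht).congr fun n => ?_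
  simp [voiOmega_zpow, hc]

lemma IsTwoCycle.sum_eq_zero {Γ : Type*} [Group Γ] {N : ℕ} {x : Fin N → ℤ} {a b : Fin N → Γ}
    (h : IsTwoCycle x a b) {R : Type*} [CommRing R] (f : Γ → R) :
    ∑ j, (x j : R) * (f (a j * b j) - f (a j) - f (b j)) = 0 := by
  have := congrArg (Finsupp.linearCombination ℤ f) h
  simp only [map_sum, map_add, map_sub, Finsupp.linearCombination_single, map_zero,
    zsmul_eq_mul] at this
  rw [← neg_eq_zero, ← this, ← Finset.sum_neg_distrib]
  exact Finset.sum_congr rfl fun j _ => by ring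

lemma tendsto_traceDefect_mul_sub {Γ : Type*} [Group Γ] {α β : Γ → ℤ}
    (hα : ∀ g h : Γ, α (g * h) = α g + α h) (hβ : ∀ g h : Γ, β (g * h) = β g + β h)
    {ψ : ∀ n : ℕ, Γ →* unitaryGroup (Fin n) ℂ}
    (hψ : ∀ g : Γ, Tendsto (fun n : ℕ =>
      frobNorm ((ψ n g : Matrix (Fin n) (Fin n) ℂ) - voiRho α β n g)) atTop (nhds 0))
    (g h : Γ) :
    Tendsto (fun n : ℕ => traceDefect α β n (ψ n) (g * h) - traceDefect α β n (ψ n) g -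
      traceDefect α β n (ψ n) h) atTop (nhds (2 * Real.pi * Complex.I * ((β g * α h : ℤ) : ℂ))) := by
  have hd (g : Γ) : Tendsto (fun n : ℕ => traceDefect α β n (ψ n) g / n) atTop (nhds 0) := by
    refine squeeze_zero_norm' ?_ (hψ g)
    filter_upwards [eventually_ge_atTop 1] with n hn
    have hn' : (1 : ℝ) ≤ n := by exact_mod_cast hn
    rw [norm_div, Complex.norm_natCast, div_le_iff₀ (by positivity)]
    refine (norm_traceDefect_le α β n (ψ n) g).trans ?_
    refine mul_le_mul_of_nonneg_left ?_ (Real.sqrt_nonneg _)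
    exact Real.sqrt_le_iff.2 ⟨by positivity, by nlinarith⟩
  have hr := squeeze_zero_norm (fun n => norm_traceDefect_mul_le hα hβ n (ψ n) g h)
    (by simpa using (hψ g).mul (hψ h))
  have hω := tendsto_mul_voiOmega_zpow_sub_one (β g * α h)
  have hlim := (hr.add hω).add (hω.mul ((hd g).add (hd h)))
  rw [zero_add, add_zero, mul_zero, add_zero] at hlim
  refine hlim.congr' ?_
  filter_upwards [eventually_ne_atTop 0] with n hn
  have hn' : (n : ℂ) ≠ 0 := by exact_mod_cast hn
  field_simp
  ring


end

/-- If the cocycle `(g,h) ↦ α(g)β(h)` pairs nontrivially with some 2-cycle, then the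
asymptotic homomorphism `(ρ_n)` is not perturbable to genuine unitary representations
in the unnormalized Frobenius norm. -/
theorem voiRho_not_perturbable_frobNorm {Γ : Type*} [Group Γ] (α β : Γ → ℤ)
    (hα : ∀ g h : Γ, α (g * h) = α g + α h) (hβ : ∀ g h : Γ, β (g * h) = β g + β h)
    (N : ℕ) (x : Fin N → ℤ) (a b : Fin N → Γ) (hcycle : IsTwoCycle x a b)
    (hpair : ∑ j : Fin N, x j * (α (a j) * β (b j)) ≠ 0) :
    ¬ ∃ ψ : ∀ n : ℕ, Γ →* Matrix.unitaryGroup (Fin n) ℂ,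
        ∀ g : Γ,
          Tendsto
            (fun n : ℕ =>
              frobNorm ((ψ n g : Matrix (Fin n) (Fin n) ℂ) - voiRho α β n g))
            atTop (nhds 0) := by
  rintro ⟨ψ, hψ⟩
  have hlim : Tendsto (fun _ : ℕ => (0 : ℂ)) atTop
      (nhds (∑ j, (x j : ℂ) * (2 * Real.pi * Complex.I * ((β (a j) * α (b j) : ℤ) : ℂ)))) :=
    (tendsto_finsetSum Finset.univ fun j _ =>
      (tendsto_traceDefect_mul_sub hα hβ hψ (a j) (b j)).const_mul (x j : ℂ)).congr
        fun n => hcycle.sum_eq_zero (traceDefect α β n (ψ n))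
  have hzero := tendsto_nhds_unique hlim tendsto_const_nhds
  have hsum : ∑ j, x j * (β (a j) * α (b j)) = 0 := by
    have h2 : (2 * Real.pi * Complex.I : ℂ) * ((∑ j, x j * (β (a j) * α (b j)) : ℤ) : ℂ) = 0 := by
      rw [← hzero, Int.cast_sum, Finset.mul_sum]
      exact Finset.sum_congr rfl fun j _ => by push_cast; ring
    exact_mod_cast (mul_eq_zero.1 h2).resolve_left Complex.two_pi_I_ne_zero
  have hsymm := hcycle.sum_eq_zero (fun g => α g * β g)
  refine hpair ?_
  rw [← hsymm, ← add_zero (∑ j, x j * (α (a j) * β (b j))), ← hsum, ← Finset.sum_add_distrib]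
  refine Finset.sum_congr rfl fun j _ => ?_
  rw [hα, hβ, Int.cast_id]
  ring
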